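/- arXiv:2102.03760 — 3 statements merged into one kernel-verified Lean document; each statement's English description precedes it below -/
import Mathlib

section
/- Let G be a connected simple graph on a finite vertex set V with (real symmetric 0/1) adjacency matrix A, and let N be the N-matrix of a mixed graph on V whose underlying graph is a spanning subgraph of G, i.e., N_{uv} = 0 whenever u and v are nonadjacent in G. Let λ₁(A) and λ₁(N) denote the largest eigenvalues of A and N, respectively. Then the following are equivalent: (a) N and A have the same characteristic polynomial; (b) λ₁(A) = λ₁(N); (c) N_{uv} ≠ 0 for every edge uv of G, and there exists a function f : V → T₆ such that N_{uv} = f(u)·conj(f(v)) for every edge uv of G; (d) there exists a diagonal matrix D whose diagonal entries lie in T₆ such that N = D*AD. -/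
open Matrix Complex

/-- The sixth root of unity `ω = (1 + i√3)/2`. -/
noncomputable def ω6 : ℂ := (1 + Complex.I * Real.sqrt 3) / 2

/-- The group `T₆ = {1, -1, ω, ω̄, -ω, -ω̄}` of sixth roots of unity in `ℂ`. -/
noncomputable def T6 : Set ℂ := {1, -1, ω6, star ω6, -ω6, -star ω6}


theorem omega_add : ω6 + star ω6 = 1 := by
  apply Complex.ext <;> simp [ω6] <;> ring

theorem omega_mul : ω6 * star ω6 = 1 := by
  have h : (Real.sqrt 3) * (Real.sqrt 3) = 3 := Real.mul_self_sqrt (by norm_num)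
  apply Complex.ext
  · simp [ω6]; nlinarith
  · simp [ω6]; ring

theorem mem_T6_iff (z : ℂ) : z ∈ T6 ↔ z ^ 6 = 1 := by
  have ha := omega_add
  have hm := omega_mul
  have hfac : z ^ 6 - 1 = (z - 1) * (z + 1) * (z - ω6) * (z - star ω6) * (z + ω6)
      * (z + star ω6) := by
    have h1 : (z - ω6) * (z - star ω6) = z ^ 2 - z + 1 := by
      linear_combination (-z) * ha + hm
    have h2 : (z + ω6) * (z + star ω6) = z ^ 2 + z + 1 := by
      linear_combination z * ha + hm
    calc z ^ 6 - 1 = (z - 1) * (z + 1) * (z ^ 2 - z + 1) * (z ^ 2 + z + 1) := by ring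
      _ = _ := by rw [← h1, ← h2]; ring
  rw [← sub_eq_zero (a := z ^ 6), hfac]
  simp only [T6, Set.mem_insert_iff, Set.mem_singleton_iff, mul_eq_zero, sub_eq_zero,
    add_eq_zero_iff_eq_neg]
  tauto

theorem norm_of_pow_six {z : ℂ} (h : z ^ 6 = 1) : ‖z‖ = 1 :=
  Complex.norm_eq_one_of_pow_eq_one h (by norm_num)

theorem star_mul_of_norm {z : ℂ} (h : ‖z‖ = 1) : star z * z = 1 := by
  have := Complex.conj_mul' z
  simpa [h] using this

theorem entry_cases {z : ℂ} (h : z ∈ ({0, 1, ω6, star ω6} : Set ℂ)) : z = 0 ∨ z ^ 6 = 1 := by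
  rw [← mem_T6_iff]
  simp only [T6, Set.mem_insert_iff, Set.mem_singleton_iff] at h ⊢
  tauto

open scoped ComplexOrder in
theorem psd_of_le {V : Type*} [Fintype V] [DecidableEq V] {A : Matrix V V ℂ}
    (hA : A.IsHermitian) (l : ℝ) (hl : ∀ i, hA.eigenvalues i ≤ l) :
    ((l : ℂ) • (1 : Matrix V V ℂ) - A).PosSemidef := by
  have hd : (Matrix.diagonal fun i => ((l - hA.eigenvalues i : ℝ) : ℂ)).PosSemidef := by
    apply Matrix.PosSemidef.diagonal
    intro i
    exact Complex.zero_le_real.2 (sub_nonneg.2 (hl i))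
  have h := hd.mul_mul_conjTranspose_same (hA.eigenvectorUnitary : Matrix V V ℂ)
  convert h using 1
  have hs := hA.spectral_theorem
  rw [Unitary.conjStarAlgAut_apply] at hs
  have h1 : (hA.eigenvectorUnitary : Matrix V V ℂ) * (hA.eigenvectorUnitary : Matrix V V ℂ)ᴴ = 1 :=
    Unitary.coe_mul_star_self hA.eigenvectorUnitary
  have hdd : (Matrix.diagonal fun i => ((l - hA.eigenvalues i : ℝ) : ℂ))
      = (l : ℂ) • (1 : Matrix V V ℂ) - Matrix.diagonal (RCLike.ofReal ∘ hA.eigenvalues) := by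
    ext i j
    by_cases hij : i = j
    · subst hij; simp
    · simp [hij]
  rw [hdd, mul_sub, sub_mul, mul_smul_comm, mul_one, smul_mul_assoc, h1]
  congr 1

open scoped ComplexOrder in
/-- Equality of the largest eigenvalues forces a gauge function on the edges. -/
theorem gauge_of_top {V : Type*} [Fintype V] [DecidableEq V]
    (G : SimpleGraph V) [DecidableRel G.Adj] (hconn : G.Connected)
    (N : Matrix V V ℂ)
    (hle : ∀ u v, ‖N u v‖ ≤ 1)
    (hspan : ∀ u v, ¬ G.Adj u v → N u v = 0)
    (l : ℝ) (hpsd : ((l : ℂ) • (1 : Matrix V V ℂ) - G.adjMatrix ℂ).PosSemidef)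
    (x : V → ℂ) (hx0 : x ≠ 0) (hx : N *ᵥ x = (l : ℂ) • x) :
    ∃ g : V → ℂ, (∀ v, ‖g v‖ = 1) ∧ ∀ u v, G.Adj u v → N u v = g u * star (g v) := by
  set y : V → ℝ := fun v => ‖x v‖ with hy
  set yc : V → ℂ := fun v => (y v : ℂ) with hyc
  set p : V → V → ℝ := fun u v => if G.Adj u v then y u * y v else 0 with hp
  set q : V → V → ℝ := fun u v => (star (x u) * N u v * x v).re with hq
  have hn : ∀ u v, ‖star (x u) * N u v * x v‖ ≤ p u v := by
    intro u v
    by_cases h : G.Adj u v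
    · simp only [hp, h, if_true, norm_mul, norm_star]
      have h1 := hle u v
      have h2 := norm_nonneg (x u)
      have h3 := norm_nonneg (x v)
      have := mul_le_mul_of_nonneg_left h1 (mul_nonneg h2 h3)
      simp only [hy]
      nlinarith
    · simp [hp, h, hspan u v h]
  have hqp : ∀ u v, q u v ≤ p u v := fun u v => (Complex.re_le_norm _).trans (hn u v)
  have hqs : ∑ u, ∑ v, q u v = l * ∑ u, y u ^ 2 := by
    have h : star x ⬝ᵥ (N *ᵥ x) = star x ⬝ᵥ ((l : ℂ) • x) := by rw [hx]
    have h2 := congrArg Complex.re h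
    simp only [dotProduct, mulVec, Finset.mul_sum, Complex.re_sum, Pi.star_apply,
      Pi.smul_apply, smul_eq_mul] at h2
    rw [Finset.mul_sum]
    calc ∑ u, ∑ v, q u v = ∑ u, ∑ v, (star (x u) * (N u v * x v)).re := by
          simp only [hq, mul_assoc]
      _ = ∑ u, (star (x u) * ((l : ℂ) * x u)).re := h2
      _ = _ := by
          apply Finset.sum_congr rfl
          intro u _
          have : star (x u) * ((l : ℂ) * x u) = ((l * y u ^ 2 : ℝ) : ℂ) := by
            have := Complex.conj_mul' (x u)
            simp only [hy]
            push_cast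
            rw [← this]
            simp only [RCLike.star_def]
            ring
          rw [this, Complex.ofReal_re]
  have hform : star yc ⬝ᵥ (((l : ℂ) • (1 : Matrix V V ℂ) - G.adjMatrix ℂ) *ᵥ yc)
      = ((l * ∑ u, y u ^ 2 - ∑ u, ∑ v, p u v : ℝ) : ℂ) := by
    rw [sub_mulVec, dotProduct_sub, smul_mulVec, one_mulVec]
    simp only [dotProduct, mulVec, Finset.mul_sum, Pi.star_apply, Pi.smul_apply, smul_eq_mul,
      hyc, hp, SimpleGraph.adjMatrix_apply]
    push_cast
    congr 1
    · apply Finset.sum_congr rfl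
      intro u _
      simp
      ring
    · apply Finset.sum_congr rfl
      intro u _
      apply Finset.sum_congr rfl
      intro v _
      split_ifs <;> simp
  have hps : ∑ u, ∑ v, p u v ≤ l * ∑ u, y u ^ 2 := by
    have h := hpsd.dotProduct_mulVec_nonneg yc
    rw [hform] at h
    have := Complex.zero_le_real.1 h
    linarith
  have hpq : ∑ u, ∑ v, p u v = ∑ u, ∑ v, q u v :=
    le_antisymm (hps.trans hqs.ge)
      (Finset.sum_le_sum fun u _ => Finset.sum_le_sum fun v _ => hqp u v)
  have hterm : ∀ u v, q u v = p u v := by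
    intro u v
    have h1 := (Finset.sum_eq_sum_iff_of_le
      (fun u _ => Finset.sum_le_sum fun v _ => hqp u v)).1 hpq.symm u (Finset.mem_univ u)
    exact (Finset.sum_eq_sum_iff_of_le (fun v _ => hqp u v)).1 h1 v (Finset.mem_univ v)
  have heig : ((l : ℂ) • (1 : Matrix V V ℂ) - G.adjMatrix ℂ) *ᵥ yc = 0 := by
    rw [← hpsd.dotProduct_mulVec_zero_iff, hform, hpq, hqs]
    simp
  have hrow : ∀ u, l * y u = ∑ v, if G.Adj u v then y v else 0 := by
    intro u
    have h := congrFun heig u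
    rw [sub_mulVec, smul_mulVec, one_mulVec] at h
    simp only [Pi.sub_apply, Pi.smul_apply, smul_eq_mul, mulVec, dotProduct,
      SimpleGraph.adjMatrix_apply, Pi.zero_apply, hyc, ite_mul, one_mul, zero_mul] at h
    have h' := sub_eq_zero.1 h
    apply Complex.ofReal_injective
    push_cast [apply_ite Complex.ofReal]
    exact h'
  have hprop : ∀ u v, G.Adj u v → y u = 0 → y v = 0 := by
    intro u v huv hu
    have h := hrow u
    rw [hu, mul_zero] at h
    have h2 := (Finset.sum_eq_zero_iff_of_nonneg (fun v _ => by
      split_ifs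
      · exact norm_nonneg _
      · exact le_rfl)).1 h.symm v (Finset.mem_univ v)
    simpa [huv] using h2
  have hypos : ∀ v, y v ≠ 0 := by
    intro v hv
    apply hx0
    funext w
    obtain ⟨W⟩ := hconn.preconnected v w
    have : y w = 0 := by
      induction W with
      | nil => exact hv
      | cons h _ ih => exact ih (hprop _ _ h hv)
    simpa [hy] using this
  refine ⟨fun v => x v / (y v : ℂ), ?_, ?_⟩
  · intro v
    have := hypos v
    simp only [norm_div, Complex.norm_real, Real.norm_eq_abs]
    rw [abs_of_nonneg (norm_nonneg _)]
    exact div_self this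
  · intro u v huv
    have hz : star (x u) * N u v * x v = ((y u * y v : ℝ) : ℂ) := by
      have h1 := hterm u v
      have h2 := hn u v
      simp only [hp, huv, if_true, hq] at h1 h2
      set z := star (x u) * N u v * x v with hzd
      have h3 : z.re = ‖z‖ := le_antisymm (Complex.re_le_norm _) (h1 ▸ h2)
      have h4 := Complex.re_eq_norm.1 h3
      have h5 := (Complex.nonneg_iff.1 h4).2
      apply Complex.ext
      · rw [h1, Complex.ofReal_re]
      · rw [← h5, Complex.ofReal_im]
    have hu : (y u : ℂ) ≠ 0 := by exact_mod_cast hypos u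
    have hv : (y v : ℂ) ≠ 0 := by exact_mod_cast hypos v
    have hxu : star (x u) * x u = (y u : ℂ) ^ 2 := Complex.conj_mul' (x u)
    have hxv : star (x v) * x v = (y v : ℂ) ^ 2 := Complex.conj_mul' (x v)
    have hsv : star (x v / (y v : ℂ)) = star (x v) / (y v : ℂ) := by simp
    rw [hsv]
    push_cast at hz
    have key : N u v * ((y u : ℂ) ^ 2 * (y v : ℂ) ^ 2)
        = x u * star (x v) * ((y u : ℂ) * (y v : ℂ)) := by
      rw [← hz, ← hxu, ← hxv]; ring
    field_simp
    apply mul_left_cancel₀ (mul_ne_zero hu hv)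
    linear_combination key

/-- Normalise the gauge function so that it takes values in `T₆`. -/
theorem gauge_T6 {V : Type*} (G : SimpleGraph V) (hconn : G.Connected)
    (N : Matrix V V ℂ) (hent : ∀ u v, N u v = 0 ∨ N u v ^ 6 = 1)
    (g : V → ℂ) (hg : ∀ v, ‖g v‖ = 1)
    (hN : ∀ u v, G.Adj u v → N u v = g u * star (g v)) :
    (∀ u v, G.Adj u v → N u v ≠ 0) ∧ ∃ f : V → ℂ, (∀ v, f v ∈ T6) ∧
      ∀ u v, G.Adj u v → N u v = f u * star (f v) := by
  have hne : ∀ u v, G.Adj u v → N u v ≠ 0 := by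
    intro u v h h0
    have h1 := congrArg norm (hN u v h)
    rw [norm_mul, norm_star, hg, hg, h0] at h1
    simp at h1
  refine ⟨hne, ?_⟩
  obtain ⟨r⟩ := hconn.nonempty
  have hone : ∀ v, star (g v) * g v = 1 := fun v => star_mul_of_norm (hg v)
  refine ⟨fun v => g v * star (g r), ?_, ?_⟩
  · have step : ∀ u v, G.Adj u v → (g u * star (g r)) ^ 6 = 1 →
        (g v * star (g r)) ^ 6 = 1 := by
      intro u v h hu
      have h6 := (hent v u).resolve_left (hne v u h.symm)
      have : g v * star (g r) = N v u * (g u * star (g r)) := by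
        rw [hN v u h.symm]
        linear_combination (-(g v * star (g r))) * hone u
      rw [this, mul_pow, h6, hu, one_mul]
    intro w
    rw [mem_T6_iff]
    obtain ⟨W⟩ := hconn.preconnected r w
    have key : ∀ a b : V, G.Walk a b → (g a * star (g r)) ^ 6 = 1 →
        (g b * star (g r)) ^ 6 = 1 := by
      intro a b W
      induction W with
      | nil => exact id
      | cons h _ ih => exact fun h0 => ih (step _ _ h h0)
    apply key r w W
    rw [mul_comm, hone, one_pow]
  · intro u v h
    rw [hN u v h]
    simp only [star_mul, star_star]
    linear_combination (-(g u * star (g v))) * hone r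

/-- Let `G` be a connected simple graph with adjacency matrix `A` and let `N`
be the N-matrix of a mixed graph whose underlying graph is a spanning subgraph of `G`.  The
following are equivalent: (a) `N` and `A` are cospectral; (b) their largest eigenvalues agree;
(c) every edge of `G` carries a nonzero entry of `N` and `N_{uv} = f(u)·conj(f(v))` on edges
for some `f : V → T₆`; (d) `N = D*AD` for a diagonal `D` with entries in `T₆`. -/
theorem cospectral_with_underlying_graph_iff
    {V : Type*} [Fintype V] [DecidableEq V] [Nonempty V]
    (G : SimpleGraph V) [DecidableRel G.Adj] (hconn : G.Connected)
    (hA : (G.adjMatrix ℂ).IsHermitian)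
    (N : Matrix V V ℂ) (hherm : N.IsHermitian)
    (hdiag : ∀ u, N u u = 0)
    (hent : ∀ u v, N u v ∈ ({0, 1, ω6, star ω6} : Set ℂ))
    (hspan : ∀ u v, ¬ G.Adj u v → N u v = 0) :
    (N.charpoly = (G.adjMatrix ℂ).charpoly ↔
        Finset.univ.sup' Finset.univ_nonempty hA.eigenvalues =
          Finset.univ.sup' Finset.univ_nonempty hherm.eigenvalues) ∧
    (N.charpoly = (G.adjMatrix ℂ).charpoly ↔
        ((∀ u v, G.Adj u v → N u v ≠ 0) ∧
          ∃ f : V → ℂ, (∀ v, f v ∈ T6) ∧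
            ∀ u v, G.Adj u v → N u v = f u * star (f v))) ∧
    (N.charpoly = (G.adjMatrix ℂ).charpoly ↔
        ∃ d : V → ℂ, (∀ v, d v ∈ T6) ∧
          N = (Matrix.diagonal d)ᴴ * G.adjMatrix ℂ * Matrix.diagonal d) := by
  have ent6 : ∀ u v, N u v = 0 ∨ N u v ^ 6 = 1 := fun u v => entry_cases (hent u v)
  have hab : N.charpoly = (G.adjMatrix ℂ).charpoly →
      Finset.univ.sup' Finset.univ_nonempty hA.eigenvalues =
          Finset.univ.sup' Finset.univ_nonempty hherm.eigenvalues := by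
    intro h
    rw [(hherm.eigenvalues_eq_eigenvalues_iff hA).2 h]
  have hbc : Finset.univ.sup' Finset.univ_nonempty hA.eigenvalues =
          Finset.univ.sup' Finset.univ_nonempty hherm.eigenvalues →
      ((∀ u v, G.Adj u v → N u v ≠ 0) ∧
          ∃ f : V → ℂ, (∀ v, f v ∈ T6) ∧
            ∀ u v, G.Adj u v → N u v = f u * star (f v)) := by
    intro h
    obtain ⟨i, -, hi⟩ := Finset.exists_mem_eq_sup' Finset.univ_nonempty hherm.eigenvalues
    have hpsd := psd_of_le hA (hherm.eigenvalues i) (fun j => by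
      rw [← hi, ← h]
      exact Finset.le_sup' hA.eigenvalues (Finset.mem_univ j))
    have hle : ∀ u v, ‖N u v‖ ≤ 1 := by
      intro u v
      rcases ent6 u v with h0 | h6
      · simp [h0]
      · exact (norm_of_pow_six h6).le
    obtain ⟨g, hg, hgN⟩ := gauge_of_top G hconn N hle hspan _ hpsd
      (⇑(hherm.eigenvectorBasis i))
      (by
        intro h0
        apply hherm.eigenvectorBasis.orthonormal.ne_zero i
        ext j
        exact congrFun h0 j)
      (by
        rw [hherm.mulVec_eigenvectorBasis i]
        ext j
        simp)
    exact gauge_T6 G hconn N ent6 g hg hgN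
  have hcd : ((∀ u v, G.Adj u v → N u v ≠ 0) ∧
          ∃ f : V → ℂ, (∀ v, f v ∈ T6) ∧
            ∀ u v, G.Adj u v → N u v = f u * star (f v)) →
      ∃ d : V → ℂ, (∀ v, d v ∈ T6) ∧
          N = (Matrix.diagonal d)ᴴ * G.adjMatrix ℂ * Matrix.diagonal d := by
    rintro ⟨-, f, hf, hfN⟩
    refine ⟨fun v => star (f v), ?_, ?_⟩
    · intro v
      have := (mem_T6_iff _).1 (hf v)
      rw [mem_T6_iff, ← star_pow, this, star_one]
    · ext u v
      rw [Matrix.diagonal_conjTranspose, Matrix.mul_diagonal, Matrix.diagonal_mul,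
        SimpleGraph.adjMatrix_apply]
      by_cases h : G.Adj u v
      · simp [h, hfN u v h]
      · simp [h, hspan u v h]
  have hda : (∃ d : V → ℂ, (∀ v, d v ∈ T6) ∧
          N = (Matrix.diagonal d)ᴴ * G.adjMatrix ℂ * Matrix.diagonal d) →
      N.charpoly = (G.adjMatrix ℂ).charpoly := by
    rintro ⟨d, hd, rfl⟩
    have h1 : Matrix.diagonal d * (Matrix.diagonal d)ᴴ = 1 := by
      rw [Matrix.diagonal_conjTranspose, Matrix.diagonal_mul_diagonal, ← Matrix.diagonal_one]
      congr 1
      funext v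
      rw [mul_comm]
      exact star_mul_of_norm (norm_of_pow_six ((mem_T6_iff _).1 (hd v)))
    rw [Matrix.charpoly_mul_comm, ← mul_assoc, h1, one_mul]
  exact ⟨⟨hab, fun h => hda (hcd (hbc h))⟩, ⟨fun h => hbc (hab h), fun h => hda (hcd h)⟩,
    ⟨fun h => hcd (hbc (hab h)), hda⟩⟩
end

section
/- Let N be the N-matrix of a mixed graph on a finite vertex set V with rank N = 2. Then there exist disjoint nonempty subsets A, B ⊆ V and a diagonal matrix D whose diagonal entries are sixth roots of unity such that the matrix D*ND satisfies: (D*ND)_{uv} = 1 if one of u, v lies in A and the other in B, and (D*ND)_{uv} = 0 otherwise. (In other words, N is switching equivalent to the disjoint union K_{a,b} ∪ tK₁ of a complete bipartite graph with some isolated vertices.) -/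
open scoped Classical

open Matrix Complex

theorem w_conj : star ω6 = 1 - ω6 := by
  unfold ω6
  apply Complex.ext <;> simp <;> ring

theorem w_sq : ω6 * ω6 = ω6 - 1 := by
  have h : ((Real.sqrt 3 : ℝ) : ℂ) * (Real.sqrt 3 : ℝ) = 3 := by
    rw [← Complex.ofReal_mul, Real.mul_self_sqrt (by norm_num)]; norm_num
  unfold ω6
  linear_combination (1 / 4 : ℂ) * ((Real.sqrt 3 : ℝ) : ℂ) * (Real.sqrt 3 : ℝ) * Complex.I_mul_I - h / 4

theorem w_re : ω6.re = 1 / 2 := by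
  unfold ω6; simp

theorem w_unit {z : ℂ} (h : z ∈ ({0, 1, ω6, star ω6} : Set ℂ)) (hz : z ≠ 0) :
    z = 1 ∨ z = ω6 ∨ z = 1 - ω6 := by
  rw [← w_conj]; simpa [hz] using h

theorem w_norm {z : ℂ} (h : z = 1 ∨ z = ω6 ∨ z = 1 - ω6) : star z * z = 1 := by
  rcases h with rfl | rfl | rfl
  · simp
  · rw [w_conj]; linear_combination -w_sq
  · rw [star_sub, w_conj, star_one]; linear_combination -w_sq

theorem w_T {z : ℂ} (h : z = 1 ∨ z = ω6 ∨ z = 1 - ω6) : z ∈ T6 := by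
  simp only [T6, w_conj, Set.mem_insert_iff, Set.mem_singleton_iff]
  tauto

theorem w_mul_T {y z : ℂ} (h : y = 1 ∨ y = ω6 ∨ y = 1 - ω6)
    (h' : z = 1 ∨ z = ω6 ∨ z = 1 - ω6) : y * z ∈ T6 := by
  have e1 : ω6 * (1 - ω6) = 1 := by linear_combination -w_sq
  have e2 : (1 - ω6) * ω6 = 1 := by linear_combination -w_sq
  have e3 : (1 - ω6) * (1 - ω6) = -ω6 := by linear_combination w_sq
  have e4 : ω6 * ω6 = -(1 - ω6) := by linear_combination w_sq
  simp only [T6, w_conj, Set.mem_insert_iff, Set.mem_singleton_iff]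
  rcases h with rfl | rfl | rfl <;> rcases h' with rfl | rfl | rfl <;>
    simp only [e1, e2, e3, e4, one_mul, mul_one, true_or, or_true]

theorem w_re_T {y z : ℂ} (h : y ∈ T6)
    (h' : z = 1 ∨ z = ω6 ∨ z = 1 - ω6) : (y * z).re ≠ 0 := by
  have e1 : ω6 * (1 - ω6) = 1 := by linear_combination -w_sq
  have e2 : (1 - ω6) * ω6 = 1 := by linear_combination -w_sq
  have e3 : (1 - ω6) * (1 - ω6) = -ω6 := by linear_combination w_sq
  have e4 : ω6 * ω6 = -(1 - ω6) := by linear_combination w_sq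
  simp only [T6, w_conj, Set.mem_insert_iff, Set.mem_singleton_iff] at h
  rcases h with rfl | rfl | rfl | rfl | rfl | rfl <;> rcases h' with rfl | rfl | rfl <;>
    simp only [neg_mul, e1, e2, e3, e4, one_mul, mul_one, Complex.neg_re, Complex.sub_re,
      Complex.one_re, w_re] <;> norm_num

theorem minor_zero {V : Type*} [Fintype V] [DecidableEq V] (N : Matrix V V ℂ)
    (hrank : N.rank = 2) (f g : Fin 3 → V) : (N.submatrix f g).det = 0 := by
  by_contra h
  have h1 := Matrix.rank_of_isUnit _ ((Matrix.isUnit_iff_isUnit_det _).2 (isUnit_iff_ne_zero.2 h))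
  have h2 := Matrix.rank_submatrix_le N f g
  simp at h1
  omega

/-- A mixed graph whose N-matrix has rank `2` is switching equivalent to the
disjoint union of a complete bipartite graph `K_{a,b}` with some isolated vertices: there are
disjoint nonempty `A, B ⊆ V` and a diagonal matrix `D` with diagonal entries in `T₆` such that
`(D*ND)_{uv} = 1` when `u, v` lie in different parts `A, B`, and `= 0` otherwise. -/
theorem rank_two_switching_equivalent_complete_bipartite
    {V : Type*} [Fintype V] [DecidableEq V]
    (N : Matrix V V ℂ) (hherm : N.IsHermitian)
    (hdiag : ∀ u, N u u = 0)
    (hent : ∀ u v, N u v ∈ ({0, 1, ω6, star ω6} : Set ℂ))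
    (hrank : N.rank = 2) :
    ∃ (A B : Set V) (d : V → ℂ), A.Nonempty ∧ B.Nonempty ∧ Disjoint A B ∧
      (∀ v, d v ∈ T6) ∧
      ∀ u v, ((Matrix.diagonal d)ᴴ * N * Matrix.diagonal d) u v =
        if (u ∈ A ∧ v ∈ B) ∨ (u ∈ B ∧ v ∈ A) then 1 else 0 := by
  have hst : ∀ u v, star (N u v) = N v u := fun u v => hherm.apply v u
  have hU : ∀ u v, N u v ≠ 0 → N u v = 1 ∨ N u v = ω6 ∨ N u v = 1 - ω6 :=
    fun u v h => w_unit (hent u v) h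
  have hne : ∀ u v, N u v ≠ 0 → N v u ≠ 0 := by
    intro u v h
    rw [← hst u v]
    exact star_ne_zero.2 h
  have hmul : ∀ u v, N u v ≠ 0 → N v u * N u v = 1 := by
    intro u v h
    rw [← hst u v]
    exact w_norm (hU u v h)
  obtain ⟨p, q, hpq⟩ : ∃ p q, N p q ≠ 0 := by
    by_contra! h
    have : N = 0 := by ext u v; exact h u v
    rw [this, Matrix.rank_zero] at hrank
    omega
  have haa := hmul p q hpq
  have key : ∀ u v, N u v = N u q * N q p * N p v + N u p * N p q * N q v := by
    intro u v
    have h := minor_zero N hrank ![p, q, u] ![p, q, v]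
    rw [Matrix.det_fin_three] at h
    simp [hdiag] at h
    linear_combination -h - N u v * haa
  have hdisj : ∀ u, N u q ≠ 0 → N u p ≠ 0 → False := by
    intro u h1 h2
    have h3 := key u u
    rw [hdiag] at h3
    have h4 : N u p * N p q * N q u = star (N u q * N q p * N p u) := by
      simp only [star_mul, hst]; ring
    rw [h4] at h3
    have h5 := congrArg Complex.re h3
    simp only [Complex.add_re, Complex.zero_re, Complex.star_def, Complex.conj_re] at h5
    exact w_re_T (w_mul_T (hU u q h1) (hU q p (hne p q hpq))) (hU p u (hne u p h2))
      (by linarith)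
  refine ⟨{u | N u q ≠ 0}, {u | N u p ≠ 0},
    fun u => if N u q ≠ 0 then N u q else if N u p ≠ 0 then N p q * N u p else 1,
    ⟨p, hpq⟩, ⟨q, hne p q hpq⟩, Set.disjoint_left.2 (fun u h1 h2 => hdisj u h1 h2), ?_, ?_⟩
  · intro v
    dsimp only
    split_ifs with h1 h2
    · exact w_T (hU _ _ h1)
    · exact w_mul_T (hU _ _ hpq) (hU _ _ h2)
    · simp [T6]
  · intro u v
    have hz : ∀ a b, N a b = 0 → N b a = 0 := by
      intro a b h
      rw [← hst a b, h, star_zero]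
    rw [Matrix.diagonal_conjTranspose, Matrix.mul_diagonal, Matrix.diagonal_mul, key u v]
    simp only [Set.mem_ofPred_eq, Pi.star_apply]
    by_cases u1 : N u q = 0 <;> by_cases u2 : N u p = 0 <;>
      by_cases v1 : N v q = 0 <;> by_cases v2 : N v p = 0 <;>
      first
      | exact (hdisj u u1 u2).elim
      | exact (hdisj v v1 v2).elim
      | (simp [u1, u2]; done)
      | (simp [u1, u2, v1, v2, hz _ _ v1, hz _ _ v2]; done)
      | (simp [u1, u2, v1, v2, hz _ _ v1]; done)
      | (simp [u1, u2, v1, v2, hz _ _ v2]; done)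
      | skip
    · have e1 := hmul u p u2
      have e2 := hmul v q v1
      simp only [u1, u2, v1, v2, hz _ _ v2, ne_eq, not_true_eq_false, not_false_eq_true, if_true,
        if_false, star_mul, hst, and_self, or_true, true_or]
      linear_combination N q p * N p q * N q v * N v q * e1 + N q p * N p q * e2 + haa
    · have e1 := hmul u q u1
      have e2 := hmul v p v2
      simp only [u1, u2, v1, v2, hz _ _ v1, ne_eq, not_true_eq_false, not_false_eq_true, if_true,
        if_false, star_mul, hst, and_self, or_true, true_or]
      linear_combination N q p * N p q * N p v * N v p * e1 + N q p * N p q * e2 + haa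
end

section
/- Let N be the N-matrix of a mixed graph on a finite vertex set V. Then every eigenvalue of N lies in {−1, 1} if and only if there exists a diagonal matrix D with diagonal entries in T₆ such that D*ND is the adjacency matrix of a perfect matching: (D*ND)_{uv} ∈ {0, 1} for all u, v, and each row contains exactly one entry equal to 1. (Equivalently, the mixed graph is switching equivalent to tK₂ for some positive integer t.) -/
open Matrix Complex

lemma normSq_ω6 : Complex.normSq ω6 = 1 := by
  have h : (√3 : ℝ) * √3 = 3 := Real.mul_self_sqrt (by norm_num)
  have h1 : ω6 = ⟨1/2, √3/2⟩ := by
    apply Complex.ext <;> simp [ω6]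
  rw [h1, Complex.normSq_mk]
  nlinarith

lemma star_mul_ω6 : star ω6 * ω6 = 1 := by
  have := Complex.normSq_eq_conj_mul_self (z := ω6)
  rw [normSq_ω6] at this
  simpa using this.symm

lemma ω6_ne_zero : ω6 ≠ 0 := by
  intro h
  have := normSq_ω6
  simp [h] at this

lemma ω6_ne_one : ω6 ≠ 1 := by
  intro h
  have := congrArg Complex.re h
  norm_num [ω6] at this

lemma ω6_ne_star : star ω6 ≠ ω6 := by
  intro h
  have := congrArg Complex.im h
  have h3 : (√3 : ℝ) > 0 := by positivity
  simp [ω6] at this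
  linarith

section
variable {V : Type*} [Fintype V] [DecidableEq V]

lemma entry_normSq {z : ℂ} (h : z ∈ ({0, 1, ω6, star ω6} : Set ℂ)) :
    Complex.normSq z = if z ≠ 0 then 1 else 0 := by
  rcases h with rfl | rfl | rfl | h
  · simp
  · simp
  · simp [normSq_ω6, ω6_ne_zero]
  · rw [Set.mem_singleton_iff] at h
    subst h
    have : star ω6 ≠ 0 := star_ne_zero.2 ω6_ne_zero
    rw [if_pos this]
    simpa using normSq_ω6

lemma sq_of_eig (N : Matrix V V ℂ) (hherm : N.IsHermitian)
    (h : ∀ i, hherm.eigenvalues i = 1 ∨ hherm.eigenvalues i = -1) : N * N = 1 := by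
  have hs := hherm.spectral_theorem
  rw [hs, ← map_mul, Matrix.diagonal_mul_diagonal]
  have : (Matrix.diagonal fun i => ((RCLike.ofReal ∘ hherm.eigenvalues) i *
      (RCLike.ofReal ∘ hherm.eigenvalues) i : ℂ)) = (1 : Matrix V V ℂ) := by
    rw [← Matrix.diagonal_one]
    congr 1
    funext i
    rcases h i with h | h <;> simp [h]
  rw [this, map_one]

lemma eig_of_sq (N : Matrix V V ℂ) (hherm : N.IsHermitian) (h : N * N = 1) (i : V) :
    hherm.eigenvalues i = 1 ∨ hherm.eigenvalues i = -1 := by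
  have h1 := hherm.mulVec_eigenvectorBasis i
  set x := WithLp.ofLp (hherm.eigenvectorBasis i) with hx
  have hx0 : x ≠ 0 := by
    intro h0
    apply hherm.eigenvectorBasis.orthonormal.ne_zero i
    ext j
    exact congrFun h0 j
  have h2 : N *ᵥ (N *ᵥ x) = x := by rw [Matrix.mulVec_mulVec, h, Matrix.one_mulVec]
  rw [h1, Matrix.mulVec_smul, h1, smul_smul] at h2
  obtain ⟨j, hj⟩ := Function.ne_iff.1 hx0
  have h3 := congrFun h2 j
  rw [Pi.smul_apply, Complex.real_smul] at h3
  have h4 : ((hherm.eigenvalues i * hherm.eigenvalues i : ℝ) : ℂ) = 1 :=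
    mul_right_cancel₀ hj (by simpa using h3)
  exact mul_self_eq_one_iff.1 (by exact_mod_cast h4)

lemma sq_iff (N : Matrix V V ℂ) (hherm : N.IsHermitian)
    (hent : ∀ u v, N u v ∈ ({0, 1, ω6, star ω6} : Set ℂ)) :
    N * N = 1 ↔ ∀ u, ∃! v, N u v ≠ 0 := by
  have hns : ∀ u v, N u v * N v u = if N u v ≠ 0 then 1 else 0 := by
    intro u v
    rw [← hherm.apply v u]
    have := Complex.mul_conj (N u v)
    rw [entry_normSq (hent u v)] at this
    refine Eq.trans this ?_
    split_ifs <;> simp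
  constructor
  · intro h u
    have h1 := congrFun (congrFun h u) u
    rw [Matrix.mul_apply, Matrix.one_apply_eq] at h1
    simp_rw [hns] at h1
    rw [Finset.sum_boole] at h1
    have h2 : (Finset.univ.filter fun v => N u v ≠ 0).card = 1 := by exact_mod_cast h1
    obtain ⟨v, hv⟩ := Finset.card_eq_one.1 h2
    have hm : ∀ w, N u w ≠ 0 ↔ w = v := by
      intro w
      have := Finset.ext_iff.1 hv w
      simpa using this
    exact ⟨v, (hm v).2 rfl, fun w hw => (hm w).1 hw⟩
  · intro h
    ext u w
    obtain ⟨v, hv, huv⟩ := h u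
    have hvu : N v u ≠ 0 := by
      rw [← hherm.apply v u]; exact star_ne_zero.2 hv
    rw [Matrix.mul_apply, Finset.sum_eq_single v]
    · by_cases hw : u = w
      · subst hw
        rw [hns, if_pos hv, Matrix.one_apply_eq]
      · rw [Matrix.one_apply_ne hw]
        by_cases h0 : N v w = 0
        · rw [h0, mul_zero]
        · exact absurd ((h v).unique hvu h0) hw
    · intro b _ hb
      by_cases h0 : N u b = 0
      · rw [h0, zero_mul]
      · exact absurd (huv b h0) hb
    · simp

lemma conj_apply' (N : Matrix V V ℂ) (d : V → ℂ) (u v : V) :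
    ((Matrix.diagonal d)ᴴ * N * Matrix.diagonal d) u v = star (d u) * N u v * d v := by
  rw [Matrix.mul_diagonal, Matrix.diagonal_conjTranspose, Matrix.diagonal_mul]
  rfl

lemma T6_ne_zero {z : ℂ} (h : z ∈ T6) : z ≠ 0 := by
  have h0 := ω6_ne_zero
  have h1 : star ω6 ≠ 0 := star_ne_zero.2 h0
  rcases h with rfl | rfl | rfl | rfl | rfl | h
  · simp
  · simp
  · exact h0
  · exact h1
  · exact neg_ne_zero.2 h0
  · rw [Set.mem_singleton_iff] at h
    rw [h]; exact neg_ne_zero.2 h1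

lemma exists_d (N : Matrix V V ℂ) (hherm : N.IsHermitian)
    (hent : ∀ u v, N u v ∈ ({0, 1, ω6, star ω6} : Set ℂ))
    (h : ∀ u, ∃! v, N u v ≠ 0) :
    ∃ d : V → ℂ, (∀ v, d v ∈ T6) ∧ ∀ u v, N u v ≠ 0 → star (d u) * N u v * d v = 1 := by
  classical
  let d : V → ℂ := fun u => if ∃ v, N u v = ω6 then ω6 else 1
  have hd : ∀ u v, N u v ≠ 0 → d u = if N u v = ω6 then ω6 else 1 := by
    intro u v huv
    by_cases hz : N u v = ω6
    · rw [if_pos hz]; exact if_pos ⟨v, hz⟩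
    · rw [if_neg hz]
      refine if_neg ?_
      rintro ⟨w, hw⟩
      have : v = w := (h u).unique huv (by rw [hw]; exact ω6_ne_zero)
      subst this
      exact hz hw
  refine ⟨d, ?_, ?_⟩
  · intro v
    by_cases hv : ∃ w, N v w = ω6
    · simp [d, hv, T6]
    · simp [d, hv, T6]
  · intro u v huv
    have hvu : N v u ≠ 0 := by
      rw [← hherm.apply v u]; exact star_ne_zero.2 huv
    rw [hd u v huv, hd v u hvu, ← hherm.apply v u]
    rcases hent u v with h | h | h | h
    · exact absurd h huv
    · rw [h]; simp [ω6_ne_one.symm]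
    · rw [h, if_pos rfl, if_neg ω6_ne_star, star_mul_ω6, mul_one]
    · rw [Set.mem_singleton_iff] at h
      rw [h, star_star, if_pos rfl, if_neg ω6_ne_star, star_one, one_mul, star_mul_ω6]

end

/-- Every eigenvalue of the N-matrix of a mixed graph lies in `{−1, 1}` iff
the mixed graph is switching equivalent to a perfect matching `tK₂`: there is a diagonal `D`
with entries in `T₆` such that `D*ND` is a `0/1` matrix with exactly one `1` in each row. -/
theorem eigenvalues_pm_one_iff_switching_equiv_perfect_matching
    {V : Type*} [Fintype V] [DecidableEq V]
    (N : Matrix V V ℂ) (hherm : N.IsHermitian)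
    (hdiag : ∀ u, N u u = 0)
    (hent : ∀ u v, N u v ∈ ({0, 1, ω6, star ω6} : Set ℂ)) :
    (∀ i, hherm.eigenvalues i = 1 ∨ hherm.eigenvalues i = -1) ↔
      ∃ d : V → ℂ, (∀ v, d v ∈ T6) ∧
        (∀ u v, ((Matrix.diagonal d)ᴴ * N * Matrix.diagonal d) u v ∈ ({0, 1} : Set ℂ)) ∧
        (∀ u, ∃! v, ((Matrix.diagonal d)ᴴ * N * Matrix.diagonal d) u v = 1) := by
  constructor
  · intro h
    have hP := (sq_iff N hherm hent).1 (sq_of_eig N hherm h)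
    obtain ⟨d, hd, hd1⟩ := exists_d N hherm hent hP
    refine ⟨d, hd, ?_, ?_⟩
    · intro u v
      rw [conj_apply']
      by_cases h0 : N u v = 0
      · left; simp [h0]
      · right; exact hd1 u v h0
    · intro u
      obtain ⟨v, hv, huv⟩ := hP u
      refine ⟨v, ?_, ?_⟩
      · simp only [conj_apply']; exact hd1 u v hv
      · intro w hw
        simp only [conj_apply'] at hw
        apply huv w
        intro h0
        simp [h0] at hw
  · rintro ⟨d, hd, h01, hex⟩
    refine eig_of_sq N hherm ((sq_iff N hherm hent).2 ?_)
    simp only [conj_apply'] at h01 hex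
    intro u
    obtain ⟨v, hv, huv⟩ := hex u
    refine ⟨v, ?_, ?_⟩
    · intro h0
      simp [h0] at hv
    · intro w hw
      apply huv w
      have hne : star (d u) * N u w * d w ≠ 0 :=
        mul_ne_zero (mul_ne_zero (star_ne_zero.2 (T6_ne_zero (hd u))) hw) (T6_ne_zero (hd w))
      rcases h01 u w with h | h
      · exact absurd h hne
      · exact h
end
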